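/- arXiv:1303.2019 — 2 statements merged into one kernel-verified Lean document; each statement's English description precedes it below -/
import Mathlib

section
/- Let k ≥ 2 be an integer and let A be a positive real number. For t ∈ (0,1) the infinite product Π_{j=0}^∞ (1 − t^{k^j})^{−1} converges to a positive real number, and lim_{t→1⁻} (1 − t)^A · Π_{j=0}^∞ (1 − t^{k^j})^{−1} = +∞; that is, for every real M there exists δ > 0 such that (1 − t)^A · Π_{j=0}^∞ (1 − t^{k^j})^{−1} > M for all t with 1 − δ < t < 1. -/
noncomputable section

lemma aux_summable (k : ℕ) (hk : 2 ≤ k) (t : ℝ) (h0 : 0 < t) (h1 : t < 1) :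
    Summable (fun j : ℕ => Real.log ((1 - t ^ k ^ j)⁻¹)) := by
  have hs : Summable (fun j : ℕ => t ^ k ^ j) := by
    refine Summable.of_nonneg_of_le (fun j => by positivity) (fun j => ?_)
      (summable_geometric_of_lt_one h0.le h1)
    exact pow_le_pow_of_le_one h0.le h1.le (Nat.lt_pow_self (by omega)).le
  have := (Real.summable_log_one_add_of_summable hs.neg).neg
  refine this.congr (fun j => ?_)
  simp only [Real.log_inv, sub_eq_add_neg]

lemma aux_lt (k : ℕ) (hk : 2 ≤ k) (t : ℝ) (h0 : 0 < t) (h1 : t < 1) (j : ℕ) :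
    0 < 1 - t ^ k ^ j := by
  have : t ^ k ^ j < 1 := pow_lt_one₀ h0.le h1 (by positivity)
  linarith

lemma aux_le (k : ℕ) (hk : 2 ≤ k) (t : ℝ) (h0 : 0 < t) (h1 : t < 1) (N : ℕ) :
    ∏ j ∈ Finset.range N, (1 - t ^ k ^ j)⁻¹ ≤ ∏' j : ℕ, (1 - t ^ k ^ j)⁻¹ := by
  have hp : ∀ j : ℕ, 0 < (1 - t ^ k ^ j)⁻¹ := fun j => inv_pos.2 (aux_lt k hk t h0 h1 j)
  have hs := aux_summable k hk t h0 h1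
  rw [← Real.rexp_tsum_eq_tprod hp hs]
  calc _ = Real.exp (∑ j ∈ Finset.range N, Real.log ((1 - t ^ k ^ j)⁻¹)) := by
        rw [Real.exp_sum]
        exact Finset.prod_congr rfl fun j _ => (Real.exp_log (hp j)).symm
    _ ≤ _ := by
        refine Real.exp_le_exp.2 (hs.sum_le_tsum _ fun j _ => Real.log_nonneg ?_)
        refine (one_le_inv₀ (aux_lt k hk t h0 h1 j)).2 ?_
        have : 0 < t ^ k ^ j := by positivity
        linarith

/-- For `t ∈ (0,1)` the infinite product `∏_{j=0}^∞ (1 - t^{k^j})⁻¹` converges to a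
positive real number, and for every positive real `A` one has
`(1-t)^A · ∏_{j=0}^∞ (1 - t^{k^j})⁻¹ → ∞` as `t → 1⁻`. -/
theorem infProd_blowup_at_one
    (k : ℕ) (hk : 2 ≤ k) (A : ℝ) (hA : 0 < A) :
    (∀ t : ℝ, t ∈ Set.Ioo (0 : ℝ) 1 →
      Multipliable (fun j : ℕ => (1 - t ^ k ^ j)⁻¹) ∧
      0 < ∏' j : ℕ, (1 - t ^ k ^ j)⁻¹) ∧
    ∀ M : ℝ, ∃ δ : ℝ, 0 < δ ∧ ∀ t : ℝ, 1 - δ < t → t < 1 →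
      M < (1 - t) ^ A * ∏' j : ℕ, (1 - t ^ k ^ j)⁻¹ := by
  constructor
  · rintro t ⟨h0, h1⟩
    have hp : ∀ j : ℕ, 0 < (1 - t ^ k ^ j)⁻¹ := fun j => inv_pos.2 (aux_lt k hk t h0 h1 j)
    have hs := aux_summable k hk t h0 h1
    refine ⟨Real.multipliable_of_summable_log hp hs, ?_⟩
    rw [← Real.rexp_tsum_eq_tprod hp hs]
    exact Real.exp_pos _
  · intro M
    obtain ⟨n, hn⟩ := exists_nat_ge A
    set C : ℝ := ∏ j ∈ Finset.range (n + 1), (k : ℝ) ^ j with hC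
    have hkp : (0 : ℝ) < k := by exact_mod_cast (by omega : 0 < k)
    have hCp : 0 < C := Finset.prod_pos fun j _ => by positivity
    refine ⟨min 1 (1 / (C * (|M| + 1))), by positivity, fun t ht h1 => ?_⟩
    have h0 : 0 < t := by linarith [min_le_left 1 (1 / (C * (|M| + 1)))]
    have hd : 1 - t < 1 / (C * (|M| + 1)) := by
      linarith [min_le_right 1 (1 / (C * (|M| + 1)))]
    have hx : 0 < 1 - t := by linarith
    have hA1 : (1 - t) ^ n ≤ (1 - t) ^ A := by
      rw [← Real.rpow_natCast]
      exact Real.rpow_le_rpow_of_exponent_ge hx (by linarith) hn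
    have hP : (C * (1 - t) ^ (n + 1))⁻¹ ≤ ∏' j : ℕ, (1 - t ^ k ^ j)⁻¹ := by
      refine le_trans ?_ (aux_le k hk t h0 h1 (n + 1))
      rw [Finset.prod_inv_distrib]
      refine inv_anti₀ (Finset.prod_pos fun j _ => aux_lt k hk t h0 h1 j) ?_
      have : C * (1 - t) ^ (n + 1) = ∏ j ∈ Finset.range (n + 1), ((k : ℝ) ^ j * (1 - t)) := by
        rw [Finset.prod_mul_distrib]; simp [hC]
      rw [this]
      refine Finset.prod_le_prod (fun j _ => (aux_lt k hk t h0 h1 j).le) fun j _ => ?_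
      have := one_add_mul_sub_le_pow (a := t) (by linarith) (k ^ j)
      push_cast at this
      linarith
    calc M < |M| + 1 := by linarith [le_abs_self M]
      _ ≤ (C * (1 - t))⁻¹ := by
        rw [lt_div_iff₀ (by positivity)] at hd
        rw [le_inv_comm₀ (by positivity) (by positivity), ← one_div,
          le_div_iff₀ (by positivity)]
        linarith
      _ = (1 - t) ^ n * (C * (1 - t) ^ (n + 1))⁻¹ := by
        have := hx.ne'
        field_simp
        ring
      _ ≤ _ := by
        gcongr
end
end

section
/- Let m be a positive integer, let d_1, …, d_m be positive integers, and let H be a subgroup of the product group (ℤ/d_1ℤ) × ⋯ × (ℤ/d_mℤ). Suppose there exist positive integers r_1, …, r_m with 1/r_1 + ⋯ + 1/r_m < 1 such that for each i ∈ {1, …, m} there is an element h_i ∈ H whose i-th coordinate has order exactly r_i in ℤ/d_iℤ. Then there exists an element h ∈ H such that no coordinate of h is zero. -/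
/-- If a subgroup `H` of `(ℤ/d₁ℤ) × ⋯ × (ℤ/d_mℤ)` contains, for each coordinate `i`, an
element whose `i`-th coordinate has order `r_i`, and `1/r₁ + ⋯ + 1/r_m < 1`, then `H`
contains an element all of whose coordinates are nonzero. -/
theorem subgroup_element_with_nonzero_coordinates
    (m : ℕ) (hm : 0 < m) (d : Fin m → ℕ) (hd : ∀ i, 0 < d i)
    (H : AddSubgroup (∀ i : Fin m, ZMod (d i)))
    (r : Fin m → ℕ) (hr : ∀ i, 0 < r i)
    (hsum : ∑ i, (1 : ℝ) / r i < 1)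
    (hord : ∀ i, ∃ h ∈ H, addOrderOf (h i) = r i) :
    ∃ h ∈ H, ∀ i, h i ≠ 0 := by
  by_contra! hcon
  have : ∀ i, NeZero (d i) := fun i => ⟨(hd i).ne'⟩
  let f : ∀ i, H →+ ZMod (d i) := fun i =>
    (Pi.evalAddMonoidHom (fun i => ZMod (d i)) i).comp H.subtype
  open scoped Pointwise in
  have hcov : ⋃ i ∈ (Finset.univ : Finset (Fin m)),
      ((0 : H) +ᵥ ((f i).ker : Set H)) = Set.univ := by
    ext x
    obtain ⟨i, hi⟩ := hcon x.1 x.2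
    simp only [Finset.mem_univ, Set.iUnion_true, Set.mem_iUnion, Set.mem_univ, iff_true, zero_vadd]
    exact ⟨i, hi⟩
  have h1 := AddSubgroup.one_le_sum_inv_index_of_leftCoset_cover hcov
  have h2 : ∀ i, r i ≤ (f i).ker.index := by
    intro i
    obtain ⟨h, hh, ho⟩ := hord i
    rw [AddSubgroup.index_ker, ← ho]
    have hmem : h i ∈ (f i).range := ⟨⟨h, hh⟩, rfl⟩
    rw [← AddSubgroup.addOrderOf_mk (h i) hmem]
    exact Nat.le_of_dvd Nat.card_pos (addOrderOf_dvd_natCard _)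
  have h3 : (1 : ℝ) ≤ ∑ i, (((f i).ker.index : ℝ))⁻¹ := by
    have h5 := (Rat.cast_le (K := ℝ)).mpr h1
    push_cast at h5
    exact h5
  have h4 : ∑ i, (((f i).ker.index : ℝ))⁻¹ ≤ ∑ i, (1 : ℝ) / r i := by
    refine Finset.sum_le_sum fun i _ => ?_
    rw [one_div]
    have := hr i
    have := h2 i
    gcongr
  linarith
end
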